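/- arXiv:2504.21298 — 5 statements merged into one kernel-verified Lean document; each statement's English description precedes it below -/
import Mathlib

section
/- Let N, D be natural numbers with 1 ≤ D < N, let 0 < α < 1, and let p : Fin N → ℝ be a nonincreasing (antitone) sequence of nonnegative reals with ∑ᵢ pᵢ = 1. Suppose the tail weight t := ∑_{i=D+1}^{N} pᵢ is strictly positive, and let S := (1/(1−α))·log(∑_{i=1}^{N} pᵢ^α) be the α-Rényi entropy. Then D ≤ (1−α) · α^{α/(1−α)} · t^{−α/(1−α)} · e^{S}. -/
/-- Weighted AM-GM for `D * h ^ α + t * h ^ (α - 1)` in logarithmic form; the bound is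
independent of `h`. -/
theorem log_bound_of_add_rpow_le {α d t h Q : ℝ} (hα0 : 0 < α) (hα1 : α < 1) (hd : 0 < d)
    (ht : 0 < t) (hh : 0 < h) (hQ : d * h ^ α + t * h ^ (α - 1) ≤ Q) :
    (1 - α) * (Real.log d - Real.log (1 - α)) + α * (Real.log t - Real.log α) ≤ Real.log Q := by
  have hβ : 0 < 1 - α := sub_pos.mpr hα1
  have ha : 0 < h ^ α := Real.rpow_pos_of_pos hh _
  have hb : 0 < h ^ (α - 1) := Real.rpow_pos_of_pos hh _
  have hx : 0 < d * h ^ α / (1 - α) := by positivity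
  have hy : 0 < t * h ^ (α - 1) / α := by positivity
  have key := Real.geom_mean_le_arith_mean2_weighted hβ.le hα0.le hx.le hy.le (by ring)
  rw [mul_div_cancel₀ _ hβ.ne', mul_div_cancel₀ _ hα0.ne'] at key
  have hlog := Real.log_le_log (by positivity) (key.trans hQ)
  rw [Real.log_mul (by positivity) (by positivity), Real.log_rpow hx, Real.log_rpow hy,
    Real.log_div (by positivity) hβ.ne', Real.log_div (by positivity) hα0.ne',
    Real.log_mul hd.ne' ha.ne', Real.log_mul ht.ne' hb.ne', Real.log_rpow hh,
    Real.log_rpow hh] at hlog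
  linarith

/-- Splitting an antitone sequence at index `D` bounds its power sum from below. -/
theorem add_rpow_le_sum_rpow_of_antitone {N D : ℕ} (hDN : D < N) {α : ℝ} (hα0 : 0 < α)
    (hα1 : α < 1) {p : Fin N → ℝ} (hanti : Antitone p) (hpos : ∀ i, 0 ≤ p i)
    (hh : 0 < p ⟨D, hDN⟩) :
    D * p ⟨D, hDN⟩ ^ α +
      (∑ i ∈ Finset.univ.filter (fun i : Fin N => D ≤ (i : ℕ)), p i) * p ⟨D, hDN⟩ ^ (α - 1) ≤
    ∑ i, p i ^ α := by
  rw [← Finset.sum_filter_add_sum_filter_not Finset.univ (fun i : Fin N => D ≤ (i : ℕ)), add_comm]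
  refine add_le_add ?_ ?_
  · rw [Finset.sum_mul]
    refine Finset.sum_le_sum fun i hi => ?_
    have hle : p i ≤ p ⟨D, hDN⟩ := hanti (by simpa [Fin.le_def] using hi)
    rcases (hpos i).eq_or_lt with h0 | h0
    · simp [← h0, hα0.ne']
    · calc p i * p ⟨D, hDN⟩ ^ (α - 1) ≤ p i * p i ^ (α - 1) :=
            mul_le_mul_of_nonneg_left
              (Real.rpow_le_rpow_of_nonpos h0 hle (by linarith)) h0.le
        _ = p i ^ α := by
            rw [Real.rpow_sub_one h0.ne', mul_div_cancel₀ _ h0.ne']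
  · have hcard : (Finset.univ.filter (fun i : Fin N => ¬ D ≤ (i : ℕ))).card = D := by
      simp only [not_le]
      rw [Fin.card_filter_val_lt, min_eq_right hDN.le]
    have hsmul := Finset.card_nsmul_le_sum
      (Finset.univ.filter (fun i : Fin N => ¬ D ≤ (i : ℕ))) (fun i => p i ^ α)
      (p ⟨D, hDN⟩ ^ α) fun i hi => by
        have hi' : (i : ℕ) < D := by simpa using hi
        exact Real.rpow_le_rpow hh.le (hanti (Fin.le_def.mpr hi'.le)) hα0.le
    rwa [hcard, nsmul_eq_mul] at hsmul


/-- Lemma 1 of the paper: bound on the bond dimension `D` in terms of the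
α-Rényi entropy `S` of the squared Schmidt coefficients `p` and the tail
weight `t` (truncation error) past index `D`. -/
theorem stmt0 (N D : ℕ) (hD : 1 ≤ D) (hDN : D < N)
    (α : ℝ) (hα0 : 0 < α) (hα1 : α < 1)
    (p : Fin N → ℝ) (hanti : Antitone p) (hpos : ∀ i, 0 ≤ p i)
    (hsum : ∑ i, p i = 1)
    (t : ℝ) (ht : t = ∑ i ∈ Finset.univ.filter (fun i : Fin N => D ≤ (i : ℕ)), p i)
    (htpos : 0 < t)
    (S : ℝ) (hS : S = (1 / (1 - α)) * Real.log (∑ i, p i ^ α)) :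
    (D : ℝ) ≤ (1 - α) * α ^ (α / (1 - α)) * t ^ (-(α / (1 - α))) * Real.exp S := by
  have hβ : 0 < 1 - α := sub_pos.mpr hα1
  have hd : (0 : ℝ) < D := by exact_mod_cast hD
  have hh : 0 < p ⟨D, hDN⟩ := by
    by_contra! hle
    refine htpos.not_ge (ht ▸ Finset.sum_nonpos fun i hi => le_trans (hanti ?_) hle)
    simpa [Fin.le_def] using hi
  have hQ := add_rpow_le_sum_rpow_of_antitone hDN hα0 hα1 hanti hpos hh
  rw [← ht] at hQ
  have hlog := log_bound_of_add_rpow_le hα0 hα1 hd htpos hh hQ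
  have hS' : (1 - α) * S = Real.log (∑ i, p i ^ α) := by
    rw [hS]
    field_simp
  rw [← hS'] at hlog
  rw [← Real.log_le_log_iff hd (by positivity), Real.log_mul (by positivity) (by positivity),
    Real.log_mul (by positivity) (by positivity), Real.log_mul hβ.ne' (by positivity),
    Real.log_rpow hα0, Real.log_rpow htpos, Real.log_exp]
  refine le_of_mul_le_mul_left ?_ hβ
  have hexp : (1 - α) * (α / (1 - α)) = α := mul_div_cancel₀ _ hβ.ne'
  linear_combination hlog + (Real.log t - Real.log α) * hexp
end

section
/- Let N, D be natural numbers with D ≤ N, let 0 < α < 1, let h > 0, and let p : Fin N → ℝ be nonnegative reals such that pᵢ ≥ h for all i ≤ D and pᵢ ≤ h for all i > D. Set t := ∑_{i=D+1}^{N} pᵢ. Then ∑_{i=1}^{N} pᵢ^α ≥ D·h^α + t·h^{α−1}. -/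
/-- Below the threshold `h`, the concave power `x ^ α` dominates its chord `x * h ^ (α - 1)`. -/
theorem mul_rpow_sub_one_le_rpow {α h x : ℝ} (hα0 : 0 < α) (hα1 : α ≤ 1)
    (hx : 0 ≤ x) (hxh : x ≤ h) : x * h ^ (α - 1) ≤ x ^ α := by
  rcases hx.eq_or_lt with rfl | hx
  · simp [Real.zero_rpow hα0.ne']
  · calc x * h ^ (α - 1) ≤ x * x ^ (α - 1) :=
          mul_le_mul_of_nonneg_left
            (Real.rpow_le_rpow_of_nonpos hx hxh (by linarith)) hx.le
      _ = x ^ α := by rw [Real.rpow_sub_one hx.ne', mul_div_cancel₀ _ hx.ne']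

/-- The key lower bound from Appendix A (Eq. (min_entropy)) used in the proof of
Lemma 1: if the first `D` entries of a nonnegative sequence are at least a
threshold `h` and the remaining entries at most `h`, then the α-power sum is
at least `D·h^α + t·h^(α−1)`, with `t` the tail weight. -/
theorem stmt1 (N D : ℕ) (hDN : D ≤ N)
    (α : ℝ) (hα0 : 0 < α) (hα1 : α < 1)
    (h : ℝ) (hh : 0 < h)
    (p : Fin N → ℝ) (hpos : ∀ i, 0 ≤ p i)
    (hbig : ∀ i : Fin N, (i : ℕ) < D → h ≤ p i)
    (hsmall : ∀ i : Fin N, D ≤ (i : ℕ) → p i ≤ h)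
    (t : ℝ) (ht : t = ∑ i ∈ Finset.univ.filter (fun i : Fin N => D ≤ (i : ℕ)), p i) :
    (D : ℝ) * h ^ α + t * h ^ (α - 1) ≤ ∑ i, p i ^ α := by
  have hcard : (Finset.univ.filter (fun i : Fin N => (i : ℕ) < D)).card = D := by
    simp [Fin.card_filter_val_lt, hDN]
  rw [← Finset.sum_filter_add_sum_filter_not Finset.univ (fun i : Fin N => (i : ℕ) < D)]
  simp only [not_lt]
  refine add_le_add ?_ ?_
  · rw [← nsmul_eq_mul]
    conv_lhs => rw [← hcard]
    refine Finset.card_nsmul_le_sum _ _ _ fun i hi => ?_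
    exact Real.rpow_le_rpow hh.le (hbig i (Finset.mem_filter.mp hi).2) hα0.le
  · rw [ht, Finset.sum_mul]
    exact Finset.sum_le_sum fun i hi => mul_rpow_sub_one_le_rpow hα0 hα1.le (hpos i)
      (hsmall i (Finset.mem_filter.mp hi).2)
end

section
/- Let n ≥ 2 and let μ be the Haar probability measure on the unitary group U(n). Then for all indices a, b, c, d, e, f, g, h ∈ Fin n, ∫ U_{ab} U_{cd} conj(U_{ef}) conj(U_{gh}) dμ(U) = (1/(n²−1)) · (δ_{ae}δ_{bf}δ_{cg}δ_{dh} + δ_{ag}δ_{bh}δ_{ce}δ_{df}) − (1/(n(n²−1))) · (δ_{ae}δ_{bh}δ_{cg}δ_{df} + δ_{ag}δ_{bf}δ_{ce}δ_{dh}). -/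
open MeasureTheory

/-- Kronecker delta with complex values. -/
noncomputable def kdelta {n : ℕ} (a b : Fin n) : ℂ := if a = b then 1 else 0

open Matrix

section InvariantTensor

variable {ι : Type*} [DecidableEq ι]

/-- The unitary matrix acting on the coordinates `p` and `q` as the square root of the
transposition, up to a phase, and fixing all other coordinates. -/
noncomputable def mixMatrix (p q : ι) : Matrix ι ι ℂ :=
  1 - ((1 - Complex.I) / 2) • vecMulVec (Pi.single p 1 + Pi.single q 1)
    (Pi.single p 1 + Pi.single q 1)

lemma mixMatrix_apply_left {p q : ι} (hpq : p ≠ q) (j : ι) :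
    mixMatrix p q p j =
      (if j = p then (1 + Complex.I) / 2 else 0) + (if j = q then (Complex.I - 1) / 2 else 0) := by
  rcases eq_or_ne j p with rfl | hp
  · simp [mixMatrix, vecMulVec_apply, hpq]
    ring
  · rcases eq_or_ne j q with rfl | hq
    · simp [mixMatrix, vecMulVec_apply, hpq, hp]
      ring
    · simp [mixMatrix, vecMulVec_apply, hp, hp.symm, hq]

variable [Fintype ι]

/-- A tensor with two covariant and two contravariant indices which is fixed by the action of
the unitary group. -/
def IsUnitaryInvariant (T : ι → ι → ι → ι → ℂ) : Prop :=
  ∀ V ∈ unitaryGroup ι ℂ, ∀ a c e g, T a c e g =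
    ∑ a', ∑ c', ∑ e', ∑ g',
      V a a' * V c c' * starRingEnd ℂ (V e e') * starRingEnd ℂ (V g g') * T a' c' e' g'

lemma sum_mul_conj_of_mem_unitaryGroup {U : Matrix ι ι ℂ} (hU : U ∈ unitaryGroup ι ℂ) (b f : ι) :
    ∑ a, U a b * starRingEnd ℂ (U a f) = if b = f then 1 else 0 := by
  have h := congrFun (congrFun (mem_unitaryGroup_iff'.1 hU) f) b
  simpa [mul_apply, one_apply, mul_comm, eq_comm] using h

lemma diagonal_mem_unitaryGroup {v : ι → ℂ} (hv : ∀ i, v i * starRingEnd ℂ (v i) = 1) :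
    diagonal v ∈ unitaryGroup ι ℂ := by
  rw [mem_unitaryGroup_iff, star_eq_conjTranspose, diagonal_conjTranspose, diagonal_mul_diagonal,
    ← diagonal_one]
  congr 1
  funext i
  simpa using hv i

lemma permMatrix_mem_unitaryGroup (σ : Equiv.Perm ι) :
    σ.permMatrix ℂ ∈ unitaryGroup ι ℂ := by
  rw [mem_unitaryGroup_iff, star_eq_conjTranspose, conjTranspose_permMatrix, ← permMatrix_mul]
  simp

lemma mixMatrix_mem_unitaryGroup {p q : ι} (hpq : p ≠ q) :
    mixMatrix p q ∈ unitaryGroup ι ℂ := by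
  set w : ι → ℂ := Pi.single p 1 + Pi.single q 1 with hw
  have hww : w ⬝ᵥ w = 2 := by
    simp [hw, hpq, hpq.symm]
    norm_num
  have hstar : star w = w := by
    funext i
    simp [hw, Pi.single_apply, apply_ite (starRingEnd ℂ)]
  have hsq : vecMulVec w w * vecMulVec w w = (2 : ℂ) • vecMulVec w w := by
    rw [vecMulVec_mul_vecMulVec, hww, vecMulVec_smul]
  have hH : (vecMulVec w w)ᴴ = vecMulVec w w := by
    rw [conjTranspose_vecMulVec, hstar]
  rw [mem_unitaryGroup_iff, star_eq_conjTranspose, mixMatrix, ← hw, conjTranspose_sub,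
    conjTranspose_smul, hH, conjTranspose_one, sub_mul, mul_sub, mul_sub, smul_mul_smul_comm, hsq,
    one_mul, mul_one, one_mul, smul_smul, sub_sub, ← add_sub_assoc, ← add_smul, ← sub_smul]
  have hz : star ((1 - Complex.I) / 2) = (1 + Complex.I) / 2 := by
    simp
  rw [hz, sub_eq_self]
  convert zero_smul ℂ _ using 2
  linear_combination Complex.I_sq / 2

namespace IsUnitaryInvariant

variable {T : ι → ι → ι → ι → ℂ}

lemma apply_eq_mul (hT : IsUnitaryInvariant T) {v : ι → ℂ}
    (hv : ∀ i, v i * starRingEnd ℂ (v i) = 1) (a c e g : ι) :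
    T a c e g = v a * v c * starRingEnd ℂ (v e) * starRingEnd ℂ (v g) * T a c e g := by
  have h := hT _ (diagonal_mem_unitaryGroup hv) a c e g
  simpa [diagonal_apply, apply_ite (starRingEnd ℂ)] using h

lemma apply_perm (hT : IsUnitaryInvariant T) (σ : Equiv.Perm ι) (a c e g : ι) :
    T (σ a) (σ c) (σ e) (σ g) = T a c e g := by
  have h := hT _ (permMatrix_mem_unitaryGroup σ) a c e g
  simpa [Equiv.Perm.permMatrix, PEquiv.toMatrix_apply, apply_ite (starRingEnd ℂ)] using h.symm

lemma apply_eq_zero (hT : IsUnitaryInvariant T) {a c e g : ι}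
    (h₁ : ¬(a = e ∧ c = g)) (h₂ : ¬(a = g ∧ c = e)) : T a c e g = 0 := by
  have key (k : ι) := hT.apply_eq_mul (v := fun i => if i = k then Complex.I else 1)
    (fun i => by split_ifs <;> simp) a c e g
  by_contra hne
  have hone (k : ι) := mul_eq_right₀ hne |>.1 (key k).symm
  have ha := hone a
  have hc := hone c
  simp only [if_true] at ha hc
  split_ifs at ha hc <;> simp [Complex.ext_iff] at ha hc <;> grind

lemma apply_self (hT : IsUnitaryInvariant T) {p q : ι} (hpq : p ≠ q) :
    T p p p p = T p q p q + T p q q p := by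
  have h := hT _ (mixMatrix_mem_unitaryGroup hpq) p p p p
  simp only [mixMatrix_apply_left hpq, map_add, apply_ite (starRingEnd ℂ), map_zero, mul_add,
    add_mul, mul_ite, ite_mul, mul_zero, zero_mul, Finset.sum_add_distrib, Finset.sum_ite_eq',
    Finset.mem_univ, if_true] at h
  have hq : T q q q q = T p p p p := by simpa using hT.apply_perm (Equiv.swap p q) p p p p
  have hX : T q p q p = T p q p q := by simpa using hT.apply_perm (Equiv.swap p q) p q p q
  have hY : T q p p q = T p q q p := by simpa using hT.apply_perm (Equiv.swap p q) p q q p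
  have hz {a c e g : ι} := hT.apply_eq_zero (a := a) (c := c) (e := e) (g := g)
  simp [hq, hX, hY, hz, hpq, hpq.symm, Complex.conj_ofNat] at h
  ring_nf at h
  simp only [Complex.I_sq, Complex.I_pow_four] at h
  linear_combination 2 * h

/-- Unitarily invariant tensors are spanned by the two contractions. -/
theorem exists_eq [Nontrivial ι] (hT : IsUnitaryInvariant T) :
    ∃ X Y : ℂ, ∀ a c e g, T a c e g =
      (if a = e ∧ c = g then X else 0) + (if a = g ∧ c = e then Y else 0) := by
  obtain ⟨p, q, hpq⟩ := exists_pair_ne ι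
  have hperm {a c : ι} (hac : a ≠ c) : ∃ σ : Equiv.Perm ι, σ p = a ∧ σ q = c := by
    refine ⟨Equiv.swap (Equiv.swap p a q) c * Equiv.swap p a, ?_, by simp⟩
    have : a ≠ Equiv.swap p a q := by
      intro h
      apply hpq
      apply (Equiv.swap p a).injective
      rw [← h, Equiv.swap_apply_left]
    simp [Equiv.swap_apply_of_ne_of_ne this hac]
  have hX {a c : ι} (hac : a ≠ c) : T a c a c = T p q p q := by
    obtain ⟨σ, rfl, rfl⟩ := hperm hac
    exact hT.apply_perm σ ..
  have hY {a c : ι} (hac : a ≠ c) : T a c c a = T p q q p := by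
    obtain ⟨σ, rfl, rfl⟩ := hperm hac
    exact hT.apply_perm σ ..
  refine ⟨T p q p q, T p q q p, fun a c e g => ?_⟩
  by_cases h₁ : a = e ∧ c = g
  · obtain ⟨rfl, rfl⟩ := h₁
    by_cases hac : a = c
    · subst hac
      obtain ⟨b, hb⟩ := exists_ne a
      simp [hT.apply_self hb.symm, hX hb.symm, hY hb.symm]
    · simp [hac, hX hac]
  · by_cases h₂ : a = g ∧ c = e
    · obtain ⟨rfl, rfl⟩ := h₂
      have hac : a ≠ c := fun h => h₁ ⟨h, h.symm⟩
      simp [hac, hY hac]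
    · simp [h₁, h₂, hT.apply_eq_zero h₁ h₂]

end IsUnitaryInvariant

end InvariantTensor

section Haar

variable {ι : Type*} [Fintype ι] [DecidableEq ι] [MeasurableSpace (unitaryGroup ι ℂ)]
  (μ : Measure (unitaryGroup ι ℂ))

/-- The integral of a product of two entries and two conjugate entries of a unitary matrix. -/
noncomputable def secondMoment (b d f h a c e g : ι) : ℂ :=
  ∫ U : unitaryGroup ι ℂ, (U : Matrix ι ι ℂ) a b * (U : Matrix ι ι ℂ) c d *
    starRingEnd ℂ ((U : Matrix ι ι ℂ) e f) * starRingEnd ℂ ((U : Matrix ι ι ℂ) g h) ∂μ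

lemma secondMoment_swap (b d f h a c e g : ι) :
    secondMoment μ b d f h a c e g = secondMoment μ b d h f a c g e := by
  unfold secondMoment
  congr 1 with U
  ring

variable [BorelSpace (unitaryGroup ι ℂ)]

lemma integrable_secondMoment [IsFiniteMeasure μ] (b d f h a c e g : ι) :
    Integrable (fun U : unitaryGroup ι ℂ => (U : Matrix ι ι ℂ) a b * (U : Matrix ι ι ℂ) c d *
      starRingEnd ℂ ((U : Matrix ι ι ℂ) e f) * starRingEnd ℂ ((U : Matrix ι ι ℂ) g h)) μ := by
  have hcont (i j : ι) : Continuous fun U : unitaryGroup ι ℂ => (U : Matrix ι ι ℂ) i j :=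
    continuous_subtype_val.matrix_elem i j
  refine Integrable.of_bound (C := 1) (Continuous.aestronglyMeasurable ?_) (.of_forall fun U => ?_)
  · exact (((hcont a b).mul (hcont c d)).mul (Complex.continuous_conj.comp (hcont e f))).mul
      (Complex.continuous_conj.comp (hcont g h))
  · have hU (i j : ι) : ‖(U : Matrix ι ι ℂ) i j‖ ≤ 1 := entry_norm_bound_of_unitary U.2 i j
    simp only [norm_mul, RCLike.norm_conj]
    exact mul_le_one₀ (mul_le_one₀ (mul_le_one₀ (hU a b) (norm_nonneg _) (hU c d))
      (norm_nonneg _) (hU e f)) (norm_nonneg _) (hU g h)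

lemma isUnitaryInvariant_secondMoment [IsFiniteMeasure μ] [μ.IsMulLeftInvariant] (b d f h : ι) :
    IsUnitaryInvariant (secondMoment μ b d f h) := by
  intro V hV a c e g
  have hint := integrable_secondMoment μ b d f h
  rw [secondMoment, ← integral_mul_left_eq_self _ (⟨V, hV⟩ : unitaryGroup ι ℂ)]
  simp only [secondMoment, ← integral_const_mul]
  have hint' (a' c' e' g' : ι) := (hint a' c' e' g').const_mul
    (V a a' * V c c' * starRingEnd ℂ (V e e') * starRingEnd ℂ (V g g'))
  simp_rw [← integral_finsetSum _ fun g' _ => hint' _ _ _ g']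
  simp_rw [← integral_finsetSum _ fun e' _ =>
    integrable_finsetSum _ fun g' _ => hint' _ _ e' g']
  simp_rw [← integral_finsetSum _ fun c' _ => integrable_finsetSum _ fun e' _ =>
    integrable_finsetSum _ fun g' _ => hint' _ c' e' g']
  rw [← integral_finsetSum _ fun a' _ => integrable_finsetSum _ fun c' _ =>
    integrable_finsetSum _ fun e' _ => integrable_finsetSum _ fun g' _ => hint' a' c' e' g']
  congr 1 with U
  simp only [Submonoid.coe_mul, mul_apply, map_sum, mul_assoc, Finset.sum_mul]
  simp only [Finset.mul_sum, map_mul]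
  refine Finset.sum_congr rfl fun _ _ => Finset.sum_congr rfl fun _ _ =>
    Finset.sum_congr rfl fun _ _ => Finset.sum_congr rfl fun _ _ => ?_
  ring

lemma sum_secondMoment_parallel [IsProbabilityMeasure μ] (b d f h : ι) :
    ∑ a, ∑ c, secondMoment μ b d f h a c a c =
      (if b = f then 1 else 0) * (if d = h then 1 else 0) := by
  have hint := integrable_secondMoment μ b d f h
  simp only [secondMoment]
  simp_rw [← integral_finsetSum _ fun c _ => hint _ c _ c]
  rw [← integral_finsetSum _ fun a _ => integrable_finsetSum _ fun c _ => hint a c a c]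
  trans ∫ _ : unitaryGroup ι ℂ, (if b = f then 1 else 0) * (if d = h then 1 else 0) ∂μ
  · congr 1 with U
    simp only [← sum_mul_conj_of_mem_unitaryGroup U.2, Finset.sum_mul_sum]
    refine Finset.sum_congr rfl fun _ _ => Finset.sum_congr rfl fun _ _ => ?_
    ring
  · simp

lemma sum_secondMoment_crossed [IsProbabilityMeasure μ] (b d f h : ι) :
    ∑ a, ∑ c, secondMoment μ b d f h a c c a =
      (if b = h then 1 else 0) * (if d = f then 1 else 0) := by
  simp only [secondMoment_swap μ b d f h, sum_secondMoment_parallel]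

end Haar

/-- Second-moment Weingarten formula (Eq. (WeingartenII)) for the Haar measure
on `U(n)`. -/
theorem stmt11 (n : ℕ) (hn : 2 ≤ n)
    [MeasurableSpace (Matrix.unitaryGroup (Fin n) ℂ)]
    [BorelSpace (Matrix.unitaryGroup (Fin n) ℂ)]
    (μ : Measure (Matrix.unitaryGroup (Fin n) ℂ))
    [μ.IsHaarMeasure] [IsProbabilityMeasure μ]
    (a b c d e f g h : Fin n) :
    ∫ U : Matrix.unitaryGroup (Fin n) ℂ,
        (U : Matrix (Fin n) (Fin n) ℂ) a b * (U : Matrix (Fin n) (Fin n) ℂ) c d *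
          starRingEnd ℂ ((U : Matrix (Fin n) (Fin n) ℂ) e f) *
          starRingEnd ℂ ((U : Matrix (Fin n) (Fin n) ℂ) g h) ∂μ
      = (1 / ((n : ℂ) ^ 2 - 1)) *
          (kdelta a e * kdelta b f * kdelta c g * kdelta d h +
           kdelta a g * kdelta b h * kdelta c e * kdelta d f)
        - (1 / ((n : ℂ) * ((n : ℂ) ^ 2 - 1))) *
          (kdelta a e * kdelta b h * kdelta c g * kdelta d f +
           kdelta a g * kdelta b f * kdelta c e * kdelta d h) := by
  have : NeZero n := ⟨by omega⟩
  have : Nontrivial (Fin n) := Fin.nontrivial_iff_two_le.2 hn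
  obtain ⟨X, Y, hXY⟩ := (isUnitaryInvariant_secondMoment μ b d f h).exists_eq
  have h₁ := sum_secondMoment_parallel μ b d f h
  have h₂ := sum_secondMoment_crossed μ b d f h
  simp only [hXY, and_self, if_true, Finset.sum_add_distrib, Finset.sum_const,
    Finset.card_univ, Fintype.card_fin, nsmul_eq_mul, eq_comm, Finset.sum_ite_eq, Finset.mem_univ] at h₁ h₂
  have hn₀ : (n : ℂ) ≠ 0 := NeZero.ne _
  have hn₁ : (n : ℂ) ^ 2 - 1 ≠ 0 := by
    rw [sub_ne_zero]
    exact_mod_cast (Nat.one_lt_pow two_ne_zero hn).ne'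
  have hX : X = 1 / ((n : ℂ) ^ 2 - 1) * (kdelta b f * kdelta d h) -
      1 / ((n : ℂ) * ((n : ℂ) ^ 2 - 1)) * (kdelta b h * kdelta d f) := by
    unfold kdelta
    field_simp
    linear_combination (n : ℂ) * h₁ - h₂
  have hY : Y = 1 / ((n : ℂ) ^ 2 - 1) * (kdelta b h * kdelta d f) -
      1 / ((n : ℂ) * ((n : ℂ) ^ 2 - 1)) * (kdelta b f * kdelta d h) := by
    unfold kdelta
    field_simp
    linear_combination (n : ℂ) * h₂ - h₁
  have hδ (i j k l : Fin n) (z : ℂ) :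
      (if i = j ∧ k = l then z else 0) = kdelta i j * kdelta k l * z := by
    simp only [kdelta, ite_and, ite_mul, one_mul, zero_mul]
  refine (hXY a c e g).trans ?_
  rw [hδ, hδ, hX, hY]
  ring
end

section
/- Let n ≥ 2, let μ be the Haar probability measure on the unitary group U(n), let X be any n×n complex matrix, and let M be an n×n complex matrix with Tr M = 0. Then ∫ |Tr(U X U† M)|² dμ(U) = (Tr(M M†)/(n²−1)) · (Tr(X X†) − |Tr X|²/n), and moreover ∫ Tr(U X U† M) dμ(U) = 0. -/
open MeasureTheory Matrix
open scoped Matrix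

/-- The average of `f (U X U†)` over the unitary group with respect to `μ`. -/
noncomputable def unitaryAverage {ι : Type*} [Fintype ι] [DecidableEq ι]
    [MeasurableSpace (unitaryGroup ι ℂ)] (μ : Measure (unitaryGroup ι ℂ))
    (X : Matrix ι ι ℂ) (f : Matrix ι ι ℂ → ℂ) : ℂ :=
  ∫ U : unitaryGroup ι ℂ, f ((U : Matrix ι ι ℂ) * X * (U : Matrix ι ι ℂ)ᴴ) ∂μ

theorem exists_perm_apply_eq_apply_eq {ι : Type*} [DecidableEq ι] {i j k l : ι}
    (hij : i ≠ j) (hkl : k ≠ l) :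
    ∃ σ : Equiv.Perm ι, σ i = k ∧ σ j = l := by
  refine ⟨Equiv.swap (Equiv.swap i k j) l * Equiv.swap i k, ?_, by simp⟩
  rw [Equiv.Perm.mul_apply, Equiv.swap_apply_left]
  refine Equiv.swap_apply_of_ne_of_ne (fun h => hij ?_) hkl
  simpa using congrArg (Equiv.swap i k) h

section UnitaryAverage

variable {ι : Type*} [Fintype ι] [DecidableEq ι]

theorem isCompact_unitaryGroup : IsCompact (unitaryGroup ι ℂ : Set (Matrix ι ι ℂ)) := by
  have hK : IsCompact (Set.univ.pi fun _ : ι => Set.univ.pi fun _ : ι =>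
      Metric.closedBall (0 : ℂ) 1) :=
    isCompact_univ_pi fun _ => isCompact_univ_pi fun _ => isCompact_closedBall 0 1
  refine hK.of_isClosed_subset (isClosed_unitary (R := Matrix ι ι ℂ)) fun U hU => ?_
  simpa [Set.mem_pi] using fun i j => entry_norm_bound_of_unitary hU i j

theorem diagonal_mem_unitaryGroup_s12 {d : ι → ℂ} (hd : ∀ i, d i * star (d i) = 1) :
    diagonal d ∈ unitaryGroup ι ℂ := by
  rw [mem_unitaryGroup_iff, star_eq_conjTranspose, diagonal_conjTranspose, diagonal_mul_diagonal]
  ext i j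
  rcases eq_or_ne i j with rfl | h
  · simpa using hd i
  · simp [h]

theorem one_submatrix_mem_unitaryGroup (σ : Equiv.Perm ι) :
    (1 : Matrix ι ι ℂ).submatrix σ id ∈ unitaryGroup ι ℂ := by
  rw [mem_unitaryGroup_iff, star_eq_conjTranspose]
  ext i j
  simp [mul_apply, one_apply, eq_comm]

/-- The reflection along `e i - 2 e j`. -/
theorem reflection_mem_unitaryGroup {i j : ι} (hij : i ≠ j) :
    (1 : Matrix ι ι ℂ) - (2 / 5 : ℂ) •
      vecMulVec (Pi.single i 1 - Pi.single j 2) (Pi.single i 1 - Pi.single j 2)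
      ∈ unitaryGroup ι ℂ := by
  set w : ι → ℂ := Pi.single i 1 - Pi.single j 2 with hw
  have hs : star w = w := by
    rw [hw, star_sub, ← Pi.single_star, ← Pi.single_star]
    simp
  have hd : w ⬝ᵥ w = 5 := by
    simp [hw, hij, hij.symm]
    norm_num
  have hc : (vecMulVec w w)ᴴ = vecMulVec w w := by
    rw [conjTranspose_vecMulVec, hs]
  have hm : vecMulVec w w * vecMulVec w w = (5 : ℂ) • vecMulVec w w := by
    rw [vecMulVec_mul_vecMulVec, hd]
    ext a b
    simp [vecMulVec_apply]
    ring
  rw [mem_unitaryGroup_iff, star_eq_conjTranspose, conjTranspose_sub, conjTranspose_smul, hc]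
  have h25 : star (2 / 5 : ℂ) = 2 / 5 := by simp
  rw [h25, conjTranspose_one, sub_mul, mul_sub, mul_sub, smul_mul_smul_comm, hm, smul_smul]
  simp only [one_mul, mul_one]
  module

theorem diagonal_conj_apply (d : ι → ℂ) (A : Matrix ι ι ℂ) (i j : ι) :
    (diagonal d * A * (diagonal d)ᴴ) i j = d i * A i j * star (d j) := by
  simp [diagonal_conjTranspose]

theorem one_submatrix_conj_apply (σ : Equiv.Perm ι) (A : Matrix ι ι ℂ) (i j : ι) :
    ((1 : Matrix ι ι ℂ).submatrix σ id * A * ((1 : Matrix ι ι ℂ).submatrix σ id)ᴴ) i j =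
      A (σ i) (σ j) := by
  simp [mul_apply, one_apply]

theorem reflection_conj_apply {i j : ι} (hij : i ≠ j) (A : Matrix ι ι ℂ) {V : Matrix ι ι ℂ}
    (hV : V = (1 : Matrix ι ι ℂ) - (2 / 5 : ℂ) •
      vecMulVec (Pi.single i 1 - Pi.single j 2) (Pi.single i 1 - Pi.single j 2)) :
    (V * A * Vᴴ) i i =
      (9 * A i i + 12 * A i j + 12 * A j i + 16 * A j j) / 25 := by
  have hrow : V i = Pi.single i (3 / 5 : ℂ) + Pi.single j (4 / 5 : ℂ) := by
    ext k
    rcases eq_or_ne k i with rfl | hk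
    · simp [hV, vecMulVec_apply, hij]
      norm_num
    rcases eq_or_ne k j with rfl | hk'
    · simp [hV, vecMulVec_apply, hij, hij.symm]
      norm_num
    · simp [hV, vecMulVec_apply, hk, hk', hk.symm]
  have hrow' : ∀ k, star (V i k) = V i k := by
    intro k
    simp only [hrow, Pi.add_apply, Pi.single_apply]
    split_ifs <;> simp
  simp only [mul_apply, conjTranspose_apply, hrow']
  simp [hrow, Pi.single_apply, add_mul, mul_add, Finset.sum_add_distrib]
  ring

theorem trace_unitary_conj {U : Matrix ι ι ℂ} (hU : U ∈ unitaryGroup ι ℂ) (X : Matrix ι ι ℂ) :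
    (U * X * Uᴴ).trace = X.trace := by
  have hU' : Uᴴ * U = 1 := mem_unitaryGroup_iff'.1 hU
  rw [trace_mul_comm, ← Matrix.mul_assoc, hU', Matrix.one_mul]

theorem trace_mul_conjTranspose_unitary_conj {U : Matrix ι ι ℂ} (hU : U ∈ unitaryGroup ι ℂ)
    (X : Matrix ι ι ℂ) :
    ((U * X * Uᴴ) * (U * X * Uᴴ)ᴴ).trace = (X * Xᴴ).trace := by
  have hU' : Uᴴ * U = 1 := mem_unitaryGroup_iff'.1 hU
  rw [← trace_unitary_conj hU (X * Xᴴ)]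
  congr 1
  simp only [conjTranspose_mul, conjTranspose_conjTranspose, Matrix.mul_assoc]
  rw [← Matrix.mul_assoc Uᴴ U, hU', Matrix.one_mul]

variable [MeasurableSpace (unitaryGroup ι ℂ)] {μ : Measure (unitaryGroup ι ℂ)}
  {X : Matrix ι ι ℂ}

theorem unitaryAverage_of_const [IsProbabilityMeasure μ] {f : Matrix ι ι ℂ → ℂ} {c : ℂ}
    (h : ∀ U ∈ unitaryGroup ι ℂ, f (U * X * Uᴴ) = c) : unitaryAverage μ X f = c := by
  unfold unitaryAverage
  simp [fun U : unitaryGroup ι ℂ => h U U.2]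

variable [BorelSpace (unitaryGroup ι ℂ)]

theorem unitaryAverage_conj [μ.IsMulLeftInvariant] (f : Matrix ι ι ℂ → ℂ) {V : Matrix ι ι ℂ}
    (hV : V ∈ unitaryGroup ι ℂ) :
    unitaryAverage μ X (fun A => f (V * A * Vᴴ)) = unitaryAverage μ X f := by
  have : ContinuousMul (unitaryGroup ι ℂ) := Submonoid.continuousMul _
  unfold unitaryAverage
  rw [← integral_mul_left_eq_self (fun U : unitaryGroup ι ℂ =>
    f ((U : Matrix ι ι ℂ) * X * (U : Matrix ι ι ℂ)ᴴ)) (⟨V, hV⟩ : unitaryGroup ι ℂ)]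
  simp [Matrix.mul_assoc]

theorem integrable_unitary_conj [IsFiniteMeasure μ] {f : Matrix ι ι ℂ → ℂ} (hf : Continuous f) :
    Integrable (fun U : unitaryGroup ι ℂ =>
      f ((U : Matrix ι ι ℂ) * X * (U : Matrix ι ι ℂ)ᴴ)) μ := by
  have : CompactSpace (unitaryGroup ι ℂ) := isCompact_iff_compactSpace.1 isCompact_unitaryGroup
  have hc : Continuous (fun U : unitaryGroup ι ℂ =>
      f ((U : Matrix ι ι ℂ) * X * (U : Matrix ι ι ℂ)ᴴ)) := by fun_prop
  simpa using hc.continuousOn.integrableOn_compact (μ := μ) isCompact_univ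

theorem unitaryAverage_sum [IsFiniteMeasure μ] {κ : Type*} (s : Finset κ) (c : κ → ℂ)
    (f : κ → Matrix ι ι ℂ → ℂ) (hf : ∀ k, Continuous (f k)) :
    unitaryAverage μ X (fun A => ∑ k ∈ s, c k * f k A) =
      ∑ k ∈ s, c k * unitaryAverage μ X (f k) := by
  unfold unitaryAverage
  rw [integral_finsetSum _ fun k _ => (integrable_unitary_conj (hf k)).const_mul (c k)]
  simp only [integral_const_mul]

/-- The second moment of the entries of `U X U†`. -/
noncomputable def entryMoment (μ : Measure (unitaryGroup ι ℂ)) (X : Matrix ι ι ℂ)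
    (i j k l : ι) : ℂ :=
  unitaryAverage μ X fun A => A i j * star (A k l)

section Invariance

variable [μ.IsMulLeftInvariant]

theorem entryMoment_phase {d : ι → ℂ} (hd : ∀ i, d i * star (d i) = 1) (i j k l : ι) :
    entryMoment μ X i j k l =
      d i * star (d j) * star (d k) * d l * entryMoment μ X i j k l := by
  conv_lhs => rw [entryMoment, ← unitaryAverage_conj _ (diagonal_mem_unitaryGroup_s12 hd)]
  rw [entryMoment, unitaryAverage, unitaryAverage, ← integral_const_mul]
  congr 1
  ext U
  simp only [diagonal_conj_apply, star_mul', star_star]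
  ring

theorem entryMoment_eq_zero {i j k l : ι} (h : ¬(i = j ∧ k = l)) (h' : ¬(i = k ∧ j = l)) :
    entryMoment μ X i j k l = 0 := by
  have hd : ∀ p q : ι, Function.update (1 : ι → ℂ) p Complex.I q *
      star (Function.update (1 : ι → ℂ) p Complex.I q) = 1 := by
    intro p q
    by_cases hq : q = p
    · subst hq; simp
    · simp [hq]
  have key := fun p => entryMoment_phase (μ := μ) (X := X) (hd p) i j k l
  have hI : (1 : ℂ) - Complex.I ≠ 0 := fun h => by simpa using congrArg Complex.re h
  have fixed : ∀ {z : ℂ}, z = Complex.I ∨ z = -1 →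
      entryMoment μ X i j k l = z * entryMoment μ X i j k l → entryMoment μ X i j k l = 0 := by
    rintro z (rfl | rfl) hz
    · exact (mul_eq_zero.1 (by linear_combination hz :
        (1 - Complex.I) * entryMoment μ X i j k l = 0)).resolve_left hI
    · linear_combination (1 / 2 : ℂ) * hz
  by_cases hij : i = j
  · have hkl : k ≠ l := fun e => h ⟨hij, e⟩
    refine fixed ?_ (key l)
    subst hij
    by_cases hil : i = l <;> simp [hil, hkl]
  by_cases hik : i = k
  · have hjl : j ≠ l := fun e => h' ⟨hik, e⟩
    refine fixed ?_ (key l)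
    subst hik
    by_cases hil : i = l <;> simp [hil, hjl]
  · refine fixed ?_ (key i)
    by_cases hil : l = i <;> simp [hil, Ne.symm hij, Ne.symm hik]

theorem entryMoment_perm (σ : Equiv.Perm ι) (i j k l : ι) :
    entryMoment μ X (σ i) (σ j) (σ k) (σ l) = entryMoment μ X i j k l := by
  rw [entryMoment, entryMoment,
    ← unitaryAverage_conj (fun A => A i j * star (A k l)) (one_submatrix_mem_unitaryGroup σ)]
  simp only [one_submatrix_conj_apply]

theorem entryMoment_diag_eq [IsFiniteMeasure μ] {i j : ι} (hij : i ≠ j) :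
    entryMoment μ X i i i i = entryMoment μ X i j i j + entryMoment μ X i i j j := by
  have h := unitaryAverage_conj (μ := μ) (X := X) (fun A => A i i * star (A i i))
    (reflection_mem_unitaryGroup hij)
  simp only [reflection_conj_apply hij _ rfl] at h
  let c : Fin 4 → ℂ := ![9 / 25, 12 / 25, 12 / 25, 16 / 25]
  let a : Fin 4 → ι := ![i, i, j, j]
  let b : Fin 4 → ι := ![i, j, i, j]
  have e : ∀ A : Matrix ι ι ℂ,
      (9 * A i i + 12 * A i j + 12 * A j i + 16 * A j j) / 25 *
        star ((9 * A i i + 12 * A i j + 12 * A j i + 16 * A j j) / 25) =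
      ∑ p : Fin 4 × Fin 4, (c p.1 * c p.2) *
        (A (a p.1) (b p.1) * star (A (a p.2) (b p.2))) := by
    intro A
    simp [Fintype.sum_prod_type, Fin.sum_univ_four, a, b, c]
    ring
  simp only [e] at h
  rw [unitaryAverage_sum _ _ _ fun p => by fun_prop] at h
  change ∑ p : Fin 4 × Fin 4, (c p.1 * c p.2) *
    entryMoment μ X (a p.1) (b p.1) (a p.2) (b p.2) = entryMoment μ X i i i i at h
  have z := fun i j k l => entryMoment_eq_zero (μ := μ) (X := X) (i := i) (j := j) (k := k) (l := l)
  have p1 := entryMoment_perm (μ := μ) (X := X) (Equiv.swap i j) i i i i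
  have p2 := entryMoment_perm (μ := μ) (X := X) (Equiv.swap i j) i j i j
  have p3 := entryMoment_perm (μ := μ) (X := X) (Equiv.swap i j) i i j j
  simp only [Equiv.swap_apply_left, Equiv.swap_apply_right] at p1 p2 p3
  simp [Fintype.sum_prod_type, Fin.sum_univ_four, a, b, c, z, hij, hij.symm, p1, p2, p3] at h
  linear_combination (-625 / 288 : ℂ) * h

theorem exists_entryMoment_eq [IsFiniteMeasure μ] [Nontrivial ι] : ∃ a c : ℂ, ∀ i j k l,
    entryMoment μ X i j k l =
      a * (if i = k ∧ j = l then 1 else 0) + c * (if i = j ∧ k = l then 1 else 0) := by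
  obtain ⟨p, q, hpq⟩ := exists_pair_ne ι
  refine ⟨entryMoment μ X p q p q, entryMoment μ X p p q q, fun i j k l => ?_⟩
  have ha : ∀ {i j}, i ≠ j → entryMoment μ X i j i j = entryMoment μ X p q p q := by
    intro i j hij
    obtain ⟨σ, rfl, rfl⟩ := exists_perm_apply_eq_apply_eq hpq hij
    exact entryMoment_perm σ p q p q
  have hc : ∀ {i j}, i ≠ j → entryMoment μ X i i j j = entryMoment μ X p p q q := by
    intro i j hij
    obtain ⟨σ, rfl, rfl⟩ := exists_perm_apply_eq_apply_eq hpq hij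
    exact entryMoment_perm σ p p q q
  by_cases h : i = k ∧ j = l <;> by_cases h' : i = j ∧ k = l
  · obtain ⟨rfl, rfl⟩ := h
    obtain ⟨rfl, -⟩ := h'
    obtain ⟨m, hm⟩ := exists_ne i
    simp [entryMoment_diag_eq hm.symm, ha hm.symm, hc hm.symm]
  · obtain ⟨rfl, rfl⟩ := h
    have hij : i ≠ j := fun e => h' ⟨e, e⟩
    simp [ha hij, hij]
  · obtain ⟨rfl, rfl⟩ := h'
    have hik : i ≠ k := fun e => h ⟨e, e⟩
    simp [hc hik, hik]
  · simp [entryMoment_eq_zero h' h, h, h']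

theorem exists_unitaryAverage_entry_eq [Nonempty ι] : ∃ m : ℂ, ∀ i j,
    unitaryAverage μ X (fun A => A i j) = if i = j then m else 0 := by
  obtain ⟨p⟩ := ‹Nonempty ι›
  refine ⟨unitaryAverage μ X fun A => A p p, fun i j => ?_⟩
  split_ifs with h
  · subst h
    rw [← unitaryAverage_conj (fun A => A p p)
      (one_submatrix_mem_unitaryGroup (Equiv.swap p i))]
    simp only [one_submatrix_conj_apply, Equiv.swap_apply_left]
  · have hd : ∀ q, Function.update (1 : ι → ℂ) i (-1) q *
        star (Function.update (1 : ι → ℂ) i (-1) q) = 1 := by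
      intro q
      by_cases hq : q = i
      · subst hq; simp
      · simp [hq]
    have := unitaryAverage_conj (μ := μ) (X := X) (fun A => A i j) (diagonal_mem_unitaryGroup_s12 hd)
    simp only [diagonal_conj_apply] at this
    simp [Ne.symm h, unitaryAverage, integral_neg] at this ⊢
    linear_combination (-1 / 2 : ℂ) * this

theorem unitaryAverage_trace_mul [IsFiniteMeasure μ] {M : Matrix ι ι ℂ} (hM : M.trace = 0) :
    unitaryAverage μ X (fun A => (A * M).trace) = 0 := by
  cases isEmpty_or_nonempty ι
  · simp [unitaryAverage, trace]
  obtain ⟨m, hm⟩ := exists_unitaryAverage_entry_eq (μ := μ) (X := X)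
  have e : ∀ A : Matrix ι ι ℂ, (A * M).trace = ∑ p : ι × ι, M p.2 p.1 * A p.1 p.2 := by
    intro A
    simp [trace, mul_apply, Fintype.sum_prod_type, mul_comm]
  simp only [e]
  rw [unitaryAverage_sum _ _ _ fun p => by fun_prop]
  simp only [hm, Fintype.sum_prod_type]
  simp only [mul_ite, mul_zero, Finset.sum_ite_eq, Finset.mem_univ, if_true]
  rw [← Finset.sum_mul]
  change M.trace * m = 0
  rw [hM, zero_mul]

end Invariance

theorem unitaryAverage_bilinear [IsFiniteMeasure μ] {a c : ℂ} (h : ∀ i j k l,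
      entryMoment μ X i j k l =
        a * (if i = k ∧ j = l then 1 else 0) + c * (if i = j ∧ k = l then 1 else 0))
    (M : Matrix ι ι ℂ) :
    unitaryAverage μ X (fun A => (A * M).trace * star (A * M).trace) =
      a * (M * Mᴴ).trace + c * (M.trace * star M.trace) := by
  have e : ∀ A : Matrix ι ι ℂ, (A * M).trace * star (A * M).trace =
      ∑ p : (ι × ι) × (ι × ι), (M p.1.2 p.1.1 * star (M p.2.2 p.2.1)) *
        (A p.1.1 p.1.2 * star (A p.2.1 p.2.2)) := by
    intro A
    have e' : (A * M).trace = ∑ p : ι × ι, M p.2 p.1 * A p.1 p.2 := by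
      simp [trace, mul_apply, Fintype.sum_prod_type, mul_comm]
    rw [e', star_sum, Finset.sum_mul_sum, ← Fintype.sum_prod_type']
    refine Finset.sum_congr rfl fun p _ => ?_
    rw [star_mul']
    ring
  simp only [e]
  rw [unitaryAverage_sum _ _ _ fun p => by fun_prop]
  change ∑ p : (ι × ι) × (ι × ι), (M p.1.2 p.1.1 * star (M p.2.2 p.2.1)) *
    entryMoment μ X p.1.1 p.1.2 p.2.1 p.2.2 = _
  simp only [h, mul_add, Finset.sum_add_distrib]
  congr 1
  · simp only [Fintype.sum_prod_type, ite_and, mul_ite, mul_one, mul_zero]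
    simp [trace, mul_apply, Finset.mul_sum]
    rw [Finset.sum_comm]
    refine Finset.sum_congr rfl fun i _ => Finset.sum_congr rfl fun j _ => ?_
    ring
  · simp only [Fintype.sum_prod_type, ite_and, mul_ite, mul_one, mul_zero]
    simp [trace, Finset.mul_sum, Finset.sum_mul]
    rw [Finset.sum_comm]
    refine Finset.sum_congr rfl fun i _ => Finset.sum_congr rfl fun j _ => ?_
    ring

/-- The traces of `X` and `X X†` determine the two constants of the second moment tensor. -/
theorem entryMoment_constants [IsProbabilityMeasure μ] {a c : ℂ} (h : ∀ i j k l,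
      entryMoment μ X i j k l =
        a * (if i = k ∧ j = l then 1 else 0) + c * (if i = j ∧ k = l then 1 else 0)) :
    a * (Fintype.card ι : ℂ) + c * (Fintype.card ι : ℂ) ^ 2 = X.trace * star X.trace ∧
      a * (Fintype.card ι : ℂ) ^ 2 + c * (Fintype.card ι : ℂ) = (X * Xᴴ).trace := by
  constructor
  · rw [← unitaryAverage_of_const (μ := μ) (X := X) (f := fun A => A.trace * star A.trace)
      (c := X.trace * star X.trace)
      fun U hU => by simp only [trace_unitary_conj hU]]
    have e : ∀ A : Matrix ι ι ℂ, A.trace * star A.trace =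
        ∑ p : ι × ι, 1 * (A p.1 p.1 * star (A p.2 p.2)) := by
      intro A
      simp [trace, Fintype.sum_prod_type, Finset.sum_mul_sum]
    simp only [e]
    rw [unitaryAverage_sum _ _ _ fun p => by fun_prop]
    change _ = ∑ p : ι × ι, 1 * entryMoment μ X p.1 p.1 p.2 p.2
    simp [h, Fintype.sum_prod_type, Finset.sum_add_distrib]
    ring
  · rw [← unitaryAverage_of_const (μ := μ) (X := X) (f := fun A => (A * Aᴴ).trace)
      fun U hU => trace_mul_conjTranspose_unitary_conj hU X]
    have e : ∀ A : Matrix ι ι ℂ, (A * Aᴴ).trace =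
        ∑ p : ι × ι, 1 * (A p.1 p.2 * star (A p.1 p.2)) := by
      intro A
      simp [trace, mul_apply, Fintype.sum_prod_type]
    simp only [e]
    rw [unitaryAverage_sum _ _ _ fun p => by fun_prop]
    change _ = ∑ p : ι × ι, 1 * entryMoment μ X p.1 p.2 p.1 p.2
    simp [h, Fintype.sum_prod_type, Finset.sum_add_distrib]
    ring

end UnitaryAverage

/-- Weingarten-calculus second-moment computation for traces against a
traceless observable `M`: the Haar average of `Tr(U X U† M)` vanishes and the
Haar average of `|Tr(U X U† M)|²` equals
`(Tr(M M†)/(n²−1)) · (Tr(X X†) − |Tr X|²/n)`. -/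
theorem stmt12 (n : ℕ) (hn : 2 ≤ n)
    [MeasurableSpace (Matrix.unitaryGroup (Fin n) ℂ)]
    [BorelSpace (Matrix.unitaryGroup (Fin n) ℂ)]
    (μ : Measure (Matrix.unitaryGroup (Fin n) ℂ))
    [μ.IsHaarMeasure] [IsProbabilityMeasure μ]
    (X M : Matrix (Fin n) (Fin n) ℂ) (hM : Matrix.trace M = 0) :
    (∫ U : Matrix.unitaryGroup (Fin n) ℂ,
        ‖Matrix.trace ((U : Matrix (Fin n) (Fin n) ℂ) * X *
            Matrix.conjTranspose (U : Matrix (Fin n) (Fin n) ℂ) * M)‖ ^ 2 ∂μ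
      = (Matrix.trace (M * Matrix.conjTranspose M)).re / ((n : ℝ) ^ 2 - 1) *
          ((Matrix.trace (X * Matrix.conjTranspose X)).re - ‖Matrix.trace X‖ ^ 2 / n)) ∧
    (∫ U : Matrix.unitaryGroup (Fin n) ℂ,
        Matrix.trace ((U : Matrix (Fin n) (Fin n) ℂ) * X *
            Matrix.conjTranspose (U : Matrix (Fin n) (Fin n) ℂ) * M) ∂μ = 0) := by
  have : Nontrivial (Fin n) := Fin.nontrivial_iff_two_le.2 hn
  refine ⟨?_, unitaryAverage_trace_mul hM⟩
  obtain ⟨a, c, h⟩ := exists_entryMoment_eq (μ := μ) (X := X)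
  obtain ⟨h₁, h₂⟩ := entryMoment_constants h
  have h₃ := unitaryAverage_bilinear h M
  have hre : ∀ Y : Matrix (Fin n) (Fin n) ℂ,
      (Y * Yᴴ).trace = (((Y * Yᴴ).trace.re : ℝ) : ℂ) := fun Y =>
    (Complex.conj_eq_iff_re.1 (by
      rw [starRingEnd_apply, ← trace_conjTranspose, conjTranspose_mul,
        conjTranspose_conjTranspose])).symm
  have hns : ∀ z : ℂ, z * star z = ((‖z‖ ^ 2 : ℝ) : ℂ) := fun z => by
    simpa using Complex.mul_conj' z
  simp only [unitaryAverage, hns] at h₃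
  rw [integral_complex_ofReal, hM, hre M, norm_zero] at h₃
  rw [hns, Fintype.card_fin] at h₁
  rw [hre X, Fintype.card_fin] at h₂
  have hn0 : (n : ℂ) ≠ 0 := by
    norm_cast
    omega
  have hn1 : (n : ℂ) ^ 2 - 1 ≠ 0 := by
    rw [sub_ne_zero]
    norm_cast
    nlinarith
  rw [← Complex.ofReal_inj, h₃]
  push_cast at h₁ ⊢
  field_simp
  linear_combination (((M * Mᴴ).trace.re : ℝ) : ℂ) * (n * h₂ - h₁)
end

section
/- Let α, β ∈ ℝ with α² + β² = 1, let φ ∈ ℝ, and let ψ ∈ ℂ²⊗ℂ² be the vector ψ = α·|00⟩ + β·e^{iφ}·|11⟩, with density matrix ρ = ψψ† (a 4×4 matrix indexed by pairs (i,k), i,k ∈ {0,1}). Let σ_l and σ_r be Hermitian 2×2 complex matrices, and let Σ = σ_l ⊗ σ_r (Kronecker product, σ_l acting on the first qubit). Define the partial trace over the second qubit by (Tr_B M)_{ij} = ∑_{k∈{0,1}} M_{(i,k),(j,k)}, and set ρ_A = Tr_B ρ. Then Tr( ρ_A · Tr_B( −i·(Σρ − ρΣ) ) ) = 2·Im( e^{−iφ}·α·β³·(σ_l)_{10}(σ_r)_{10}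 + e^{iφ}·α³·β·(σ_l)_{01}(σ_r)_{01} ). In particular, for σ_l = σ_r = X (the Pauli X matrix) this equals 2·sin(φ)·(α³β − αβ³). -/
open Matrix

/-- Partial trace over the second qubit of a two-qubit operator. -/
noncomputable def trB (M : Matrix (Fin 2 × Fin 2) (Fin 2 × Fin 2) ℂ) :
    Matrix (Fin 2) (Fin 2) ℂ :=
  fun i j => ∑ k : Fin 2, M (i, k) (j, k)

/-- Twice the imaginary part of a complex number, as `-i (z - z̄)`. -/
lemma two_mul_im_eq_neg_I_mul_sub_conj (z : ℂ) :
    ((2 * z.im : ℝ) : ℂ) = -Complex.I * (z - starRingEnd ℂ z) := by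
  apply Complex.ext <;> simp
  ring

/-- The explicit two-qubit gradient computation of Appendix C: for
`ψ = α|00⟩ + β e^{iφ}|11⟩` and Hermitian `σ_l, σ_r`, the quantity
`Tr(ρ_A · Tr_B(−i[σ_l⊗σ_r, ρ]))` equals
`2·Im(e^{−iφ} α β³ (σ_l)_{10}(σ_r)_{10} + e^{iφ} α³ β (σ_l)_{01}(σ_r)_{01})`;
for `σ_l = σ_r = X` this is `2 sin(φ)(α³β − αβ³)`. -/
theorem stmt14 (a b φ : ℝ) (hnorm : a ^ 2 + b ^ 2 = 1)
    (σl σr : Matrix (Fin 2) (Fin 2) ℂ)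
    (hl : σl.IsHermitian) (hr : σr.IsHermitian)
    (ψ : Fin 2 × Fin 2 → ℂ)
    (hψ : ψ = fun p => if p = (0, 0) then (a : ℂ)
        else if p = (1, 1) then (b : ℂ) * Complex.exp (Complex.I * φ) else 0)
    (ρ : Matrix (Fin 2 × Fin 2) (Fin 2 × Fin 2) ℂ)
    (hρ : ρ = fun p q => ψ p * starRingEnd ℂ (ψ q))
    (Sg : Matrix (Fin 2 × Fin 2) (Fin 2 × Fin 2) ℂ)
    (hSg : Sg = Matrix.kroneckerMap (· * ·) σl σr)
    (ρA : Matrix (Fin 2) (Fin 2) ℂ) (hρA : ρA = trB ρ) :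
    Matrix.trace (ρA * trB ((-Complex.I) • (Sg * ρ - ρ * Sg)))
      = ((2 * (Complex.exp (-Complex.I * φ) * a * (b : ℂ) ^ 3 * σl 1 0 * σr 1 0
          + Complex.exp (Complex.I * φ) * (a : ℂ) ^ 3 * b * σl 0 1 * σr 0 1).im : ℝ) : ℂ) ∧
    (σl = !![0, 1; 1, 0] → σr = !![0, 1; 1, 0] →
      Matrix.trace (ρA * trB ((-Complex.I) • (Sg * ρ - ρ * Sg)))
        = ((2 * Real.sin φ * (a ^ 3 * b - a * b ^ 3) : ℝ) : ℂ)) := by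
  have hl' : ∀ i j, starRingEnd ℂ (σl i j) = σl j i := fun i j => hl.apply j i
  have hr' : ∀ i j, starRingEnd ℂ (σr i j) = σr j i := fun i j => hr.apply j i
  have hexp : starRingEnd ℂ (Complex.exp (Complex.I * φ)) = Complex.exp (-Complex.I * φ) := by
    rw [← Complex.exp_conj]
    simp
  have hexp' : starRingEnd ℂ (Complex.exp (-Complex.I * φ)) = Complex.exp (Complex.I * φ) := by
    rw [← hexp, Complex.conj_conj]
  have hmul : Complex.exp (Complex.I * φ) * Complex.exp (-Complex.I * φ) = 1 := by
    rw [← Complex.exp_add]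
    simp
  have main : Matrix.trace (ρA * trB ((-Complex.I) • (Sg * ρ - ρ * Sg)))
      = ((2 * (Complex.exp (-Complex.I * φ) * a * (b : ℂ) ^ 3 * σl 1 0 * σr 1 0
          + Complex.exp (Complex.I * φ) * (a : ℂ) ^ 3 * b * σl 0 1 * σr 0 1).im : ℝ) : ℂ) := by
    rw [two_mul_im_eq_neg_I_mul_sub_conj]
    have hρ' : ∀ p q, ρ p q = ψ p * starRingEnd ℂ (ψ q) := fun p q => by rw [hρ]
    have hSg' : ∀ i j k l, Sg (i, k) (j, l) = σl i j * σr k l := fun i j k l => by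
      rw [hSg, Matrix.kroneckerMap_apply]
    clear hρ hSg
    subst hψ hρA
    simp only [map_add, map_mul, map_pow, Complex.conj_ofReal, hl', hr', hexp, hexp']
    generalize Complex.exp (-Complex.I * φ) = f at *
    generalize Complex.exp (Complex.I * φ) = e at *
    simp [Matrix.trace, Matrix.mul_apply, trB, Fintype.sum_prod_type, hρ', hSg', hexp]
    linear_combination (-Complex.I) * (a * b ^ 3 * (f * σl 1 0 * σr 1 0 - e * σl 0 1 * σr 0 1)) * hmul
  refine ⟨main, fun hσl hσr => ?_⟩
  rw [main, hσl, hσr]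
  congr 1
  have him : (Complex.exp (Complex.I * φ)).im = Real.sin φ := by
    rw [mul_comm, Complex.exp_ofReal_mul_I_im]
  have him' : (Complex.exp (-Complex.I * φ)).im = -Real.sin φ := by
    rw [← hexp, Complex.conj_im, him]
  have hab : Complex.exp (-Complex.I * φ) * a * (b : ℂ) ^ 3
      + Complex.exp (Complex.I * φ) * (a : ℂ) ^ 3 * b
      = Complex.exp (-Complex.I * φ) * ((a * b ^ 3 : ℝ) : ℂ)
        + Complex.exp (Complex.I * φ) * ((a ^ 3 * b : ℝ) : ℂ) := by
    push_cast
    ring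
  simp only [Matrix.of_apply, Matrix.cons_val', Matrix.cons_val_zero, Matrix.cons_val_one,
    mul_one]
  rw [hab, Complex.add_im, Complex.im_mul_ofReal, Complex.im_mul_ofReal, him, him']
  ring
end
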